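/- arXiv:2311.07790 — 6 statements merged into one kernel-verified Lean document; each statement's English description precedes it below -/
import Mathlib

section
/- Let H : [0,∞) × ℝ^n → ℝ be continuous with p ↦ H(t,p) convex for each t ≥ 0, let J : ℝ^n → ℝ be convex, and for t ≥ 0 set g_t(p) = J*(p) + ∫₀ᵗ H(s,p) ds (valued in ℝ ∪ {+∞}) and S(·,t) = (g_t)*. Assume g_0 = J* is proper (not identically +∞). Then for all 0 ≤ t₁ ≤ t₂, the semigroup identity ( (S(·,t₁))* + ∫_{t₁}^{t₂} H(λ,·) dλ )* = S(·,t₂) holds pointwise on ℝ^n; in particular (S(·,t₁))* = g_{t₁}. -/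
open scoped RealInnerProductSpace

/-- The Fenchel–Legendre transform of an `EReal`-valued function on `ℝ^n`,
`f*(p) = sup_x (⟨x,p⟩ - f(x))`, valued in `ℝ ∪ {+∞}` (here `EReal`). -/
noncomputable def fenchel {n : ℕ} (f : EuclideanSpace ℝ (Fin n) → EReal)
    (p : EuclideanSpace ℝ (Fin n)) : EReal :=
  ⨆ x : EuclideanSpace ℝ (Fin n), ((⟪x, p⟫ : ℝ) : EReal) - f x

open MeasureTheory in
theorem convexOn_intervalIntegral {E : Type*} [AddCommGroup E] [Module ℝ E]
    {H : ℝ → E → ℝ} {a b : ℝ} (hab : a ≤ b)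
    (hint : ∀ p, IntervalIntegrable (fun s => H s p) volume a b)
    (hconv : ∀ s ∈ Set.Icc a b, ConvexOn ℝ Set.univ (H s)) :
    ConvexOn ℝ Set.univ (fun p => ∫ s in a..b, H s p) := by
  refine ⟨convex_univ, fun x _ y _ α β hα hβ hαβ => ?_⟩
  simp only [smul_eq_mul]
  rw [← intervalIntegral.integral_const_mul, ← intervalIntegral.integral_const_mul,
    ← intervalIntegral.integral_add ((hint x).const_mul α) ((hint y).const_mul β)]
  exact intervalIntegral.integral_mono_on hab (hint _)
    (((hint x).const_mul α).add ((hint y).const_mul β))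
    fun s hs => (hconv s hs).2 (Set.mem_univ x) (Set.mem_univ y) hα hβ hαβ

theorem ConvexOn.exists_inner_add_le {n : ℕ} {K : EuclideanSpace ℝ (Fin n) → ℝ}
    (hK : ConvexOn ℝ Set.univ K) {p : EuclideanSpace ℝ (Fin n)} {a : ℝ} (ha : a < K p) :
    ∃ (v : EuclideanSpace ℝ (Fin n)) (c : ℝ), (∀ q, ⟪v, q⟫ + c ≤ K q) ∧ ⟪v, p⟫ + c = a := by
  obtain ⟨l, c, hle, heq⟩ := hK.exists_affine_le_of_lt (𝕜 := ℝ) (Set.mem_univ p) ha isClosed_univ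
    (hK.continuousOn isOpen_univ).lowerSemicontinuousOn
  refine ⟨(InnerProductSpace.toDual ℝ _).symm l, c, fun q => ?_, ?_⟩
  · rw [InnerProductSpace.toDual_symm_apply]
    exact hle ⟨q, Set.mem_univ q⟩
  · rw [InnerProductSpace.toDual_symm_apply]
    exact heq

theorem EReal.sub_le_of_sub_le_coe {a b : EReal} {r : ℝ} (h : (r : EReal) - a ≤ b) :
    (r : EReal) - b ≤ a := by
  induction a <;> induction b <;> simp_all [← EReal.coe_sub]
  linarith

theorem fenchel_fenchel_le {n : ℕ} (f : EuclideanSpace ℝ (Fin n) → EReal)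
    (p : EuclideanSpace ℝ (Fin n)) : fenchel (fenchel f) p ≤ f p := by
  refine iSup_le fun z => EReal.sub_le_of_sub_le_coe ?_
  rw [real_inner_comm]
  exact le_iSup (fun x => ((⟪x, z⟫ : ℝ) : EReal) - f x) p

theorem le_fenchel_fenchel_of_affine_le {n : ℕ} {f : EuclideanSpace ℝ (Fin n) → EReal}
    {v : EuclideanSpace ℝ (Fin n)} {c : ℝ} (h : ∀ q, ((⟪v, q⟫ + c : ℝ) : EReal) ≤ f q)
    (p : EuclideanSpace ℝ (Fin n)) : ((⟪v, p⟫ + c : ℝ) : EReal) ≤ fenchel (fenchel f) p := by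
  have hv : fenchel f v ≤ ((-c : ℝ) : EReal) := by
    refine iSup_le fun q => EReal.sub_le_of_sub_le_coe ?_
    rw [real_inner_comm, ← EReal.coe_sub, sub_neg_eq_add]
    exact h q
  calc ((⟪v, p⟫ + c : ℝ) : EReal) = ((⟪v, p⟫ : ℝ) : EReal) - ((-c : ℝ) : EReal) := by
        rw [← EReal.coe_sub, sub_neg_eq_add]
    _ ≤ ((⟪v, p⟫ : ℝ) : EReal) - fenchel f v := EReal.sub_le_sub le_rfl hv
    _ ≤ fenchel (fenchel f) p := le_iSup (fun x => ((⟪x, p⟫ : ℝ) : EReal) - fenchel f x) v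

/-- The sum of a conjugate function and a finite convex function is its own biconjugate: it is
a supremum of affine functions, because each of the two summands is. -/
theorem fenchel_fenchel_fenchel_add {n : ℕ} (J : EuclideanSpace ℝ (Fin n) → ℝ)
    {K : EuclideanSpace ℝ (Fin n) → ℝ} (hK : ConvexOn ℝ Set.univ K)
    (p : EuclideanSpace ℝ (Fin n)) :
    fenchel (fenchel fun q => fenchel (fun z => (J z : EReal)) q + (K q : EReal)) p
      = fenchel (fun z => (J z : EReal)) p + (K p : EReal) := by
  refine le_antisymm (fenchel_fenchel_le _ p) ?_
  rw [← EReal.le_sub_iff_add_le (Or.inl (EReal.coe_ne_bot _)) (Or.inl (EReal.coe_ne_top _))]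
  refine iSup_le fun x => ?_
  rw [EReal.le_sub_iff_add_le (Or.inl (EReal.coe_ne_bot _)) (Or.inl (EReal.coe_ne_top _)),
    ← EReal.coe_sub, ← EReal.coe_add, ← EReal.ge_of_forall_gt_iff_ge]
  intro a ha
  have ha' : a - (⟪x, p⟫ - J x) < K p := by
    have := EReal.coe_lt_coe_iff.1 ha
    linarith
  obtain ⟨v, c, hle, heq⟩ := hK.exists_inner_add_le ha'
  have haff : a = ⟪x + v, p⟫ + (c - J x) := by
    rw [inner_add_left]
    linarith
  rw [haff]
  refine le_fenchel_fenchel_of_affine_le (fun q => ?_) p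
  calc ((⟪x + v, q⟫ + (c - J x) : ℝ) : EReal)
      ≤ ((⟪x, q⟫ - J x + K q : ℝ) : EReal) := by
        rw [EReal.coe_le_coe_iff, inner_add_left]
        linarith [hle q]
    _ = (((⟪x, q⟫ : ℝ) : EReal) - (J x : EReal)) + (K q : EReal) := by
        rw [EReal.coe_add, EReal.coe_sub]
    _ ≤ fenchel (fun z => (J z : EReal)) q + (K q : EReal) :=
        add_le_add_left (le_iSup (fun y => ((⟪y, q⟫ : ℝ) : EReal) - (J y : EReal)) x) _

/-- Semigroup identity for the generalized Hopf formula: if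
`g_t(p) = J*(p) + ∫₀ᵗ H(s,p) ds` and `S(·,t) = (g_t)*`, with `H` continuous on
`[0,∞) × ℝ^n` and convex in `p`, `J` convex, and `J*` proper, then for all
`0 ≤ t₁ ≤ t₂` we have `((S(·,t₁))* + ∫_{t₁}^{t₂} H(λ,·) dλ)* = S(·,t₂)`
pointwise, and in particular `(S(·,t₁))* = g_{t₁}`. -/
theorem stmt1 {n : ℕ} (H : ℝ → EuclideanSpace ℝ (Fin n) → ℝ)
    (J : EuclideanSpace ℝ (Fin n) → ℝ)
    (hHcont : ContinuousOn (fun q : ℝ × EuclideanSpace ℝ (Fin n) => H q.1 q.2)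
      (Set.Ici 0 ×ˢ Set.univ))
    (hHconv : ∀ t : ℝ, 0 ≤ t → ConvexOn ℝ Set.univ (H t))
    (hJ : ConvexOn ℝ Set.univ J)
    (g : ℝ → EuclideanSpace ℝ (Fin n) → EReal)
    (hg : ∀ t p, g t p = fenchel (fun z => (J z : EReal)) p
      + ((∫ s in (0:ℝ)..t, H s p : ℝ) : EReal))
    (S : EuclideanSpace ℝ (Fin n) → ℝ → EReal)
    (hS : ∀ x t, S x t = fenchel (g t) x)
    (hproper : ∃ p, fenchel (fun z => (J z : EReal)) p ≠ ⊤) :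
    ∀ t₁ t₂ : ℝ, 0 ≤ t₁ → t₁ ≤ t₂ →
      (∀ x, fenchel
          (fun p => fenchel (fun z => S z t₁) p + ((∫ s in t₁..t₂, H s p : ℝ) : EReal)) x
        = S x t₂)
      ∧ (∀ p, fenchel (fun z => S z t₁) p = g t₁ p) := by
  intro t₁ t₂ h₁ h₁₂
  have hint : ∀ a b : ℝ, 0 ≤ a → a ≤ b → ∀ p,
      IntervalIntegrable (fun s => H s p) MeasureTheory.volume a b := by
    intro a b ha hab p
    refine ContinuousOn.intervalIntegrable_of_Icc hab ?_
    exact hHcont.comp (f := fun s : ℝ => (s, p)) (by fun_prop)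
      fun s hs => ⟨ha.trans hs.1, Set.mem_univ p⟩
  have hbiconj : ∀ p, fenchel (fun z => S z t₁) p = g t₁ p := by
    intro p
    have hSt : (fun z => S z t₁) = fenchel (g t₁) := funext fun z => hS z t₁
    have hgt : g t₁ = fun q => fenchel (fun z => (J z : EReal)) q
        + ((∫ s in (0:ℝ)..t₁, H s q : ℝ) : EReal) := funext (hg t₁)
    rw [hSt, hgt]
    exact fenchel_fenchel_fenchel_add J
      (convexOn_intervalIntegral h₁ (hint 0 t₁ le_rfl h₁) fun s hs => hHconv s hs.1) p
  refine ⟨fun x => ?_, hbiconj⟩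
  rw [hS]
  congr 1
  funext p
  rw [hbiconj, hg, hg, add_assoc, ← EReal.coe_add,
    intervalIntegral.integral_add_adjacent_intervals (hint 0 t₁ le_rfl h₁ p) (hint t₁ t₂ h₁ h₁₂ p)]
end

section
/- Let H : [0,∞) × ℝ^n → ℝ be continuous with p ↦ H(t,p) convex for each t ≥ 0, let J : ℝ^n → ℝ be convex, and define S(x,t) = sup_{p ∈ ℝ^n} { ⟨x,p⟩ − ∫₀ᵗ H(s,p) ds − J*(p) }; assume S(x,t) is finite for all (x,t) ∈ ℝ^n × [0,∞). Let t₀ > 0, x₀ ∈ ℝ^n, and suppose (p,q) ∈ ℝ^n × ℝ is a subgradient of S at (x₀,t₀), i.e., S(x,t) ≥ S(x₀,t₀) + ⟨p, x − x₀⟩ + q(t − t₀) for all (x,t) ∈ ℝ^n × [0,∞). Then for every s ∈ (0, t₀], q·s + ∫_{t₀−s}^{t₀} H(λ,p) dλ ≥ 0. -/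
open scoped RealInnerProductSpace

/-- Fenchel–Moreau in epigraph form: a closed convex set `A` which is stable upwards in the second
variable and has a real-valued support function `σ` contains every point that is compatible
with `σ`. -/
theorem mem_of_inner_sub_le_of_isLUB {E : Type*} [NormedAddCommGroup E] [InnerProductSpace ℝ E]
    [CompleteSpace E] {A : Set (E × ℝ)} (hclosed : IsClosed A) (hconv : Convex ℝ A)
    (hup : ∀ y r r', (y, r) ∈ A → r ≤ r' → (y, r') ∈ A) {σ : E → ℝ}
    (hσ : ∀ x, IsLUB ((fun a : E × ℝ => ⟪x, a.1⟫ - a.2) '' A) (σ x))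
    {p : E} {c : ℝ} (h : ∀ x, ⟪x, p⟫ - σ x ≤ c) : (p, c) ∈ A := by
  by_contra hmem
  obtain ⟨f, u, hfu, huf⟩ := geometric_hahn_banach_closed_point hconv hclosed hmem
  obtain ⟨a, b, hf⟩ : ∃ (a : E) (b : ℝ), ∀ y r, f (y, r) = ⟪a, y⟫ + b * r := by
    refine ⟨(InnerProductSpace.toDual ℝ E).symm (f.comp (ContinuousLinearMap.inl ℝ E ℝ)),
      f (0, 1), fun y r => ?_⟩
    rw [InnerProductSpace.toDual_symm_apply]
    have hyr : ((y, r) : E × ℝ) = (y, 0) + r • (0, 1) := by simp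
    rw [hyr, map_add, map_smul]
    simp [mul_comm]
  have hA : ∀ y r, (y, r) ∈ A → ⟪a, y⟫ + b * r < u := fun y r hy => hf y r ▸ hfu _ hy
  rw [hf] at huf
  obtain ⟨y₀, r₀, h₀⟩ : ∃ y r, (y, r) ∈ A := by
    obtain ⟨_, ⟨z, hz, -⟩⟩ := (hσ 0).nonempty
    exact ⟨z.1, z.2, hz⟩
  have hσle : ∀ x v, (∀ y r, (y, r) ∈ A → ⟪x, y⟫ - r ≤ v) → σ x ≤ v := by
    intro x v hv
    refine (hσ x).2 ?_
    rintro _ ⟨⟨y, r⟩, hy, rfl⟩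
    exact hv y r hy
  rcases lt_trichotomy b 0 with hb | hb | hb
  · have hb' : 0 < (-b)⁻¹ := by simpa using hb
    have hmul : ∀ w r : ℝ, (-b)⁻¹ * (w + b * r) = (-b)⁻¹ * w - r := by
      intro w r
      have hne : b ≠ 0 := hb.ne
      rw [inv_neg, mul_add, neg_mul b⁻¹ (b * r), inv_mul_cancel_left₀ hne, sub_eq_add_neg]
    have hσa := hσle ((-b)⁻¹ • a) ((-b)⁻¹ * u) fun y r hy => by
      rw [real_inner_smul_left, ← hmul]
      exact mul_le_mul_of_nonneg_left (hA y r hy).le hb'.le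
    have hp := h ((-b)⁻¹ • a)
    have hlt := mul_lt_mul_of_pos_left huf hb'
    rw [hmul] at hlt
    rw [real_inner_smul_left] at hp
    linarith
  · subst hb
    simp only [zero_mul, add_zero] at hA huf
    have hδ : 0 < ⟪a, p⟫ - u := sub_pos.2 huf
    set k := (|c + σ 0| + 1) / (⟪a, p⟫ - u)
    have hk0 : 0 ≤ k := by positivity
    have hkδ : k * (⟪a, p⟫ - u) = |c + σ 0| + 1 := div_mul_cancel₀ _ hδ.ne'
    have hσk := hσle (k • a) (σ 0 + k * u) fun y r hy => by
      have h0 : ⟪(0 : E), y⟫ - r ≤ σ 0 := (hσ 0).1 ⟨(y, r), hy, rfl⟩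
      rw [inner_zero_left] at h0
      have := mul_le_mul_of_nonneg_left (hA y r hy).le hk0
      rw [real_inner_smul_left]
      linarith
    have hp := h (k • a)
    rw [real_inner_smul_left] at hp
    have := le_abs_self (c + σ 0)
    linarith
  · have hM : 0 ≤ |u - ⟪a, y₀⟫ - b * r₀| / b := by positivity
    have := hA y₀ _ (hup y₀ r₀ (r₀ + |u - ⟪a, y₀⟫ - b * r₀| / b) h₀ (by linarith))
    rw [mul_add, mul_div_cancel₀ _ hb.ne'] at this
    have := le_abs_self (u - ⟪a, y₀⟫ - b * r₀)
    linarith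

theorem fenchel_coe_le_coe_iff {n : ℕ} {J : EuclideanSpace ℝ (Fin n) → ℝ}
    {p : EuclideanSpace ℝ (Fin n)} {r : ℝ} :
    fenchel (fun z => (J z : EReal)) p ≤ r ↔ ∀ z, ⟪z, p⟫ - J z ≤ r := by
  simp only [fenchel, iSup_le_iff]
  exact forall_congr' fun z => by rw [← EReal.coe_sub, EReal.coe_le_coe_iff]

/-- A real value of the supremum `sup_y (g y - J*(y))` is the least upper bound of the
real numbers `g y - r` with `J*(y) ≤ r`. -/
theorem isLUB_of_coe_eq_iSup_sub_fenchel {n : ℕ} {J g : EuclideanSpace ℝ (Fin n) → ℝ} {v : ℝ}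
    (hv : (v : EReal) = ⨆ y, ((g y : EReal) - fenchel (fun z => (J z : EReal)) y)) :
    IsLUB {w | ∃ y r, (∀ z, ⟪z, y⟫ - J z ≤ r) ∧ w = g y - r} v := by
  constructor
  · rintro _ ⟨y, r, hr, rfl⟩
    rw [← EReal.coe_le_coe_iff, hv, EReal.coe_sub]
    exact le_trans (EReal.sub_le_sub le_rfl (fenchel_coe_le_coe_iff.2 hr))
      (le_iSup (fun y => (g y : EReal) - fenchel (fun z => (J z : EReal)) y) y)
  · intro w hw
    rw [← EReal.coe_le_coe_iff, hv]
    refine iSup_le fun y => ?_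
    have hbot : (((⟪0, y⟫ - J 0 : ℝ)) : EReal) ≤ fenchel (fun z => (J z : EReal)) y := by
      rw [EReal.coe_sub]
      exact le_iSup (fun z => ((⟪z, y⟫ : ℝ) : EReal) - (J z : EReal)) 0
    generalize hF : fenchel (fun z => (J z : EReal)) y = F at hbot ⊢
    induction F with
    | bot => exact absurd hbot (by simp)
    | top => simp
    | coe r =>
      rw [← EReal.coe_sub, EReal.coe_le_coe_iff]
      exact hw ⟨y, r, fenchel_coe_le_coe_iff.1 hF.le, rfl⟩

section Primitive

variable {E : Type*} [NormedAddCommGroup E] {H : ℝ → E → ℝ}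

theorem intervalIntegrable_of_continuousOn_Ici
    (hH : ContinuousOn (fun q : ℝ × E => H q.1 q.2) (Set.Ici 0 ×ˢ Set.univ))
    {a b : ℝ} (ha : 0 ≤ a) (hb : 0 ≤ b) (y : E) :
    IntervalIntegrable (fun s => H s y) MeasureTheory.volume a b := by
  refine ContinuousOn.intervalIntegrable ?_
  refine hH.comp (f := fun s : ℝ => (s, y)) (by fun_prop) fun s hs => ⟨?_, Set.mem_univ _⟩
  exact (le_min ha hb).trans hs.1

theorem continuous_integral_of_continuousOn_Ici
    (hH : ContinuousOn (fun q : ℝ × E => H q.1 q.2) (Set.Ici 0 ×ˢ Set.univ))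
    {t : ℝ} (ht : 0 ≤ t) : Continuous fun y => ∫ s in (0 : ℝ)..t, H s y := by
  have hcont : Continuous fun z : E × ℝ => H (max z.2 0) z.1 :=
    hH.comp_continuous (f := fun z : E × ℝ => (max z.2 0, z.1)) (by fun_prop)
      fun z => ⟨le_max_right z.2 0, Set.mem_univ _⟩
  have heq : (fun y => ∫ s in (0 : ℝ)..t, H s y) = fun y => ∫ s in (0 : ℝ)..t, H (max s 0) y := by
    funext y
    refine intervalIntegral.integral_congr fun s hs => ?_
    rw [Set.uIcc_of_le ht] at hs
    simp only [max_eq_left hs.1]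
  rw [heq]
  exact intervalIntegral.continuous_parametric_intervalIntegral_of_continuous'
    (f := fun y s => H (max s 0) y) hcont 0 t

theorem convexOn_integral_of_continuousOn_Ici [NormedSpace ℝ E]
    (hH : ContinuousOn (fun q : ℝ × E => H q.1 q.2) (Set.Ici 0 ×ˢ Set.univ))
    (hconv : ∀ t : ℝ, 0 ≤ t → ConvexOn ℝ Set.univ (H t)) {t : ℝ} (ht : 0 ≤ t) :
    ConvexOn ℝ Set.univ fun y => ∫ s in (0 : ℝ)..t, H s y := by
  refine ⟨convex_univ, fun x _ y _ a b ha hb hab => ?_⟩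
  have hint := intervalIntegrable_of_continuousOn_Ici hH le_rfl ht
  simp only [smul_eq_mul]
  rw [← intervalIntegral.integral_const_mul, ← intervalIntegral.integral_const_mul,
    ← intervalIntegral.integral_add ((hint x).const_mul a) ((hint y).const_mul b)]
  refine intervalIntegral.integral_mono_on ht (hint _)
    (((hint x).const_mul a).add ((hint y).const_mul b)) fun s hs => ?_
  exact (hconv s hs.1).2 (Set.mem_univ x) (Set.mem_univ y) ha hb hab

end Primitive

/-- If `S` is the (finite-valued) generalized Hopf formula
`S(x,t) = sup_p { ⟨x,p⟩ − ∫₀ᵗ H(s,p) ds − J*(p) }` for a continuous Hamiltonian `H`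
convex in `p` and convex initial data `J`, and `(p,q)` is a subgradient of `S` at
`(x₀,t₀)` (relative to `ℝ^n × [0,∞)`) with `t₀ > 0`, then for every `s ∈ (0,t₀]`,
`q·s + ∫_{t₀−s}^{t₀} H(λ,p) dλ ≥ 0`. -/
theorem stmt3 {n : ℕ} (H : ℝ → EuclideanSpace ℝ (Fin n) → ℝ)
    (J : EuclideanSpace ℝ (Fin n) → ℝ)
    (hHcont : ContinuousOn (fun q : ℝ × EuclideanSpace ℝ (Fin n) => H q.1 q.2)
      (Set.Ici 0 ×ˢ Set.univ))
    (hHconv : ∀ t : ℝ, 0 ≤ t → ConvexOn ℝ Set.univ (H t))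
    (hJ : ConvexOn ℝ Set.univ J)
    (S : EuclideanSpace ℝ (Fin n) → ℝ → ℝ)
    (hS : ∀ x : EuclideanSpace ℝ (Fin n), ∀ t : ℝ, 0 ≤ t →
      (S x t : EReal) = ⨆ p : EuclideanSpace ℝ (Fin n),
        (((⟪x, p⟫ - ∫ s in (0:ℝ)..t, H s p : ℝ) : EReal)
          - fenchel (fun z => (J z : EReal)) p))
    (t₀ : ℝ) (ht₀ : 0 < t₀) (x₀ p : EuclideanSpace ℝ (Fin n)) (q : ℝ)
    (hsub : ∀ x : EuclideanSpace ℝ (Fin n), ∀ t : ℝ, 0 ≤ t →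
      S x₀ t₀ + ⟪p, x - x₀⟫ + q * (t - t₀) ≤ S x t) :
    ∀ s : ℝ, 0 < s → s ≤ t₀ → 0 ≤ q * s + ∫ l in (t₀ - s)..t₀, H l p := by
  intro s hs hst
  have ht : 0 ≤ t₀ - s := sub_nonneg.2 hst
  have hKcont := continuous_integral_of_continuousOn_Ici hHcont ht
  have hKconv := convexOn_integral_of_continuousOn_Ici hHcont hHconv ht
  have hadj := intervalIntegral.integral_add_adjacent_intervals
    (intervalIntegrable_of_continuousOn_Ici hHcont le_rfl ht p)
    (intervalIntegrable_of_continuousOn_Ici hHcont ht ht₀.le p)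
  set K : EuclideanSpace ℝ (Fin n) → ℝ := fun y => ∫ l in (0 : ℝ)..(t₀ - s), H l y with hK
  let A : Set (EuclideanSpace ℝ (Fin n) × ℝ) := {a | ∀ z, ⟪z, a.1⟫ - J z + K a.1 ≤ a.2}
  have hclosed : IsClosed A := by
    simp only [A, Set.ofPred_forall]
    exact isClosed_iInter fun z => isClosed_le (by fun_prop) continuous_snd
  have hconv : Convex ℝ A := by
    rintro ⟨y, r⟩ hy ⟨y', r'⟩ hy' a b ha hb hab z
    have h1 := mul_le_mul_of_nonneg_left (hy z) ha
    have h2 := mul_le_mul_of_nonneg_left (hy' z) hb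
    have h3 := hKconv.2 (Set.mem_univ y) (Set.mem_univ y') ha hb hab
    have h4 : J z = a * J z + b * J z := by rw [← add_mul, hab, one_mul]
    simp only [Prod.fst_add, Prod.snd_add, Prod.smul_fst, Prod.smul_snd, inner_add_right,
      real_inner_smul_right, smul_eq_mul] at h1 h2 h3 ⊢
    linarith
  have hmem : (p, ⟪x₀, p⟫ - S x₀ t₀ + q * s) ∈ A := by
    refine mem_of_inner_sub_le_of_isLUB hclosed hconv
      (fun y r r' hy hr z => (hy z).trans hr) (σ := fun x => S x (t₀ - s)) (fun x => ?_)
      fun x => ?_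
    · convert isLUB_of_coe_eq_iSup_sub_fenchel (hS x _ ht) using 1
      ext w
      constructor
      · rintro ⟨⟨y, r⟩, hy, rfl⟩
        exact ⟨y, r - K y, fun z => by linarith [hy z], by simp only [hK]; ring⟩
      · rintro ⟨y, r, hr, rfl⟩
        exact ⟨(y, r + K y), fun z => by linarith [hr z], by simp only [hK]; ring⟩
    · have := hsub x _ ht
      rw [inner_sub_right, real_inner_comm x p, real_inner_comm x₀ p] at this
      linarith
  have hle := (isLUB_of_coe_eq_iSup_sub_fenchel (hS x₀ t₀ ht₀.le)).1
    ⟨p, ⟪x₀, p⟫ - S x₀ t₀ + q * s - K p, fun z => by linarith [hmem z], rfl⟩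
  simp only [hK] at hle
  linarith
end

section
/- Let H : [0,∞) × ℝ^n → ℝ be continuous, let J : ℝ^n → ℝ be convex, and define S(x,t) = sup_{p ∈ ℝ^n} { ⟨x,p⟩ − ∫₀ᵗ H(s,p) ds − J*(p) }; assume S is finite-valued. Let t₀ > 0 and x₀ ∈ ℝ^n, suppose the supremum defining S(x₀,t₀) is attained at some p* ∈ ℝ^n, and suppose S is differentiable at (x₀,t₀). Then ∇_x S(x₀,t₀) = p* and ∂S/∂t(x₀,t₀) + H(t₀, p*) = 0; in particular, S satisfies the Hamilton–Jacobi equation ∂_t S(x₀,t₀) + H(t₀, ∇_x S(x₀,t₀)) = 0 at every such point of differentiability. -/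
open scoped RealInnerProductSpace

/-- A differentiable function touched from below at an interior point has the same derivative
there as the function touching it. -/
theorem HasFDerivAt.eq_of_eventually_le {E : Type*} [NormedAddCommGroup E] [NormedSpace ℝ E]
    {f g : E → ℝ} {f' g' : E →L[ℝ] ℝ} {a : E} (hf : HasFDerivAt f f' a)
    (hg : HasFDerivAt g g' a) (hle : ∀ᶠ x in nhds a, g x ≤ f x) (heq : g a = f a) : f' = g' := by
  have hmin : IsLocalMin (f - g) a := by
    filter_upwards [hle] with x hx
    simp only [Pi.sub_apply]
    linarith
  exact sub_eq_zero.mp (hmin.hasFDerivAt_eq_zero (hf.sub hg))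

/-- The fundamental theorem of calculus at an interior point of a half-line of continuity. -/
theorem hasDerivAt_integral_of_continuousOn_Ici {h : ℝ → ℝ} {a t : ℝ}
    (hh : ContinuousOn h (Set.Ici a)) (ht : a < t) :
    HasDerivAt (fun u => ∫ s in a..u, h s) (h t) t := by
  refine intervalIntegral.integral_hasDerivAt_right ?_ ?_ (hh.continuousAt (Ici_mem_nhds ht))
  · apply ContinuousOn.intervalIntegrable
    rw [Set.uIcc_of_le ht.le]
    exact hh.mono Set.Icc_subset_Ici_self
  · exact (hh.mono Set.Ioi_subset_Ici_self).stronglyMeasurableAtFilter isOpen_Ioi t ht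

/-- At a point of differentiability of the (finite-valued) generalized Hopf formula
`S(x,t) = sup_p { ⟨x,p⟩ − ∫₀ᵗ H(s,p) ds − J*(p) }` where the supremum is attained at
`p*`, we have `∇ₓS(x₀,t₀) = p*` and `∂ₜS(x₀,t₀) + H(t₀,p*) = 0`; in particular `S`
satisfies the Hamilton–Jacobi equation at `(x₀,t₀)`. Differentiability at `(x₀,t₀)`
is expressed by a Fréchet derivative of the form `(v,τ) ↦ ⟨Dx, v⟩ + Dt·τ`. -/
theorem stmt6 {n : ℕ} (H : ℝ → EuclideanSpace ℝ (Fin n) → ℝ)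
    (J : EuclideanSpace ℝ (Fin n) → ℝ)
    (hHcont : ContinuousOn (fun q : ℝ × EuclideanSpace ℝ (Fin n) => H q.1 q.2)
      (Set.Ici 0 ×ˢ Set.univ))
    (hJ : ConvexOn ℝ Set.univ J)
    (S : EuclideanSpace ℝ (Fin n) → ℝ → ℝ)
    (hS : ∀ x : EuclideanSpace ℝ (Fin n), ∀ t : ℝ, 0 ≤ t →
      (S x t : EReal) = ⨆ p : EuclideanSpace ℝ (Fin n),
        (((⟪x, p⟫ - ∫ s in (0:ℝ)..t, H s p : ℝ) : EReal)
          - fenchel (fun z => (J z : EReal)) p))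
    (t₀ : ℝ) (ht₀ : 0 < t₀) (x₀ pstar : EuclideanSpace ℝ (Fin n))
    (hatt : (S x₀ t₀ : EReal)
      = ((⟪x₀, pstar⟫ - ∫ s in (0:ℝ)..t₀, H s pstar : ℝ) : EReal)
        - fenchel (fun z => (J z : EReal)) pstar)
    (Dx : EuclideanSpace ℝ (Fin n)) (Dt : ℝ)
    (hdiff : HasFDerivAt (fun xt : EuclideanSpace ℝ (Fin n) × ℝ => S xt.1 xt.2)
      ((innerSL ℝ Dx).comp (ContinuousLinearMap.fst ℝ (EuclideanSpace ℝ (Fin n)) ℝ)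
        + Dt • ContinuousLinearMap.snd ℝ (EuclideanSpace ℝ (Fin n)) ℝ) (x₀, t₀)) :
    Dx = pstar ∧ Dt + H t₀ pstar = 0 := by
  obtain ⟨c, hc⟩ : ∃ c : ℝ, fenchel (fun z => (J z : EReal)) pstar = (c : EReal) := by
    revert hatt
    induction fenchel (fun z => (J z : EReal)) pstar with
    | bot => exact fun h => absurd h (by simp [-EReal.coe_sub])
    | coe c => exact fun _ => ⟨c, rfl⟩
    | top => intro h; simp at h
  have hint := hasDerivAt_integral_of_continuousOn_Ici (h := fun s => H s pstar) (a := 0)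
    (hHcont.comp (f := fun s : ℝ => (s, pstar)) (by fun_prop) fun s hs => ⟨hs, trivial⟩) ht₀
  have hinner : HasFDerivAt (fun xt : EuclideanSpace ℝ (Fin n) × ℝ => ⟪pstar, xt.1⟫)
      ((innerSL ℝ pstar).comp (ContinuousLinearMap.fst ℝ (EuclideanSpace ℝ (Fin n)) ℝ))
      (x₀, t₀) :=
    ((innerSL ℝ pstar).comp (ContinuousLinearMap.fst ℝ (EuclideanSpace ℝ (Fin n)) ℝ)).hasFDerivAt
  have hcomp := hint.comp_hasFDerivAt (x₀, t₀)
    (hasFDerivAt_snd (𝕜 := ℝ) (E := EuclideanSpace ℝ (Fin n)) (F := ℝ))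
  have hderiv := hdiff.eq_of_eventually_le ((hinner.sub hcomp).sub_const c) ?_ ?_
  · constructor
    · refine ext_inner_right ℝ fun v => ?_
      simpa using congrArg (fun L => L (v, 0)) hderiv
    · have h := congrArg (fun L => L (0, 1)) hderiv
      simp at h
      linarith
  · filter_upwards [continuousAt_snd.eventually (lt_mem_nhds ht₀)] with xt hxt
    have h := (le_iSup (fun p => (((⟪xt.1, p⟫ - ∫ s in (0:ℝ)..xt.2, H s p : ℝ) : EReal)
      - fenchel (fun z => (J z : EReal)) p)) pstar).trans_eq (hS xt.1 xt.2 hxt.le).symm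
    simp only [hc] at h
    rw [real_inner_comm] at h
    exact_mod_cast h
  · rw [hc, real_inner_comm] at hatt
    exact_mod_cast hatt.symm
end

section
/- Let Φ : [0,∞) → ℝ^{m×n} and y : [0,∞) → ℝ^m be continuous, let M ∈ ℝ^{n×n} be symmetric positive definite, let b ∈ ℝ^n, and define S(x,t) = sup_{p ∈ ℝ^n} { ⟨x,p⟩ − ∫₀ᵗ ½‖Φ(s)p − y(s)‖₂² ds − ½pᵀMp }. Then for every t ≥ 0, min_{θ ∈ ℝ^n} [ ∫₀ᵗ ½‖Φ(s)θ − y(s)‖₂² ds + ½(θ − M⁻¹b)ᵀ M (θ − M⁻¹b) ] = −S(b,t) + ½ bᵀM⁻¹b; that is, the minimal value of the regularized learning problem equals the negative of the generalized Hopf formula evaluated at (b,t), up to the additive constant ½bᵀM⁻¹b. -/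
open Matrix

/-- A positive definite quadratic form on `ℝⁿ` is bounded below by a multiple of the squared norm. -/
theorem Matrix.PosDef.exists_pos_mul_norm_sq_le {n : ℕ} {M : Matrix (Fin n) (Fin n) ℝ}
    (hM : M.PosDef) :
    ∃ c : ℝ, 0 < c ∧ ∀ x : Fin n → ℝ, c * ‖x‖ ^ 2 ≤ x ⬝ᵥ M.mulVec x := by
  have hpos : ∀ x : Fin n → ℝ, x ≠ 0 → 0 < x ⬝ᵥ M.mulVec x := fun x hx => by
    simpa using hM.dotProduct_mulVec_pos hx
  have hcont : Continuous fun x : Fin n → ℝ => x ⬝ᵥ M.mulVec x := by fun_prop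
  obtain ⟨c, hc, hle⟩ := (isCompact_sphere (0 : Fin n → ℝ) 1).exists_forall_le'
    hcont.continuousOn (a := 0) fun x hx => hpos x (by
      rintro rfl
      simp at hx)
  refine ⟨c, hc, fun x => ?_⟩
  rcases eq_or_ne x 0 with rfl | hx
  · simp
  have hnorm : ‖x‖ ≠ 0 := norm_ne_zero_iff.mpr hx
  have h := hle (‖x‖⁻¹ • x) (by simp [norm_smul, hnorm])
  simp only [Matrix.mulVec_smul, dotProduct_smul, smul_dotProduct, smul_eq_mul] at h
  calc c * ‖x‖ ^ 2 ≤ (‖x‖⁻¹ * (‖x‖⁻¹ * (x ⬝ᵥ M.mulVec x))) * ‖x‖ ^ 2 := by gcongr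
    _ = x ⬝ᵥ M.mulVec x := by field_simp

/-- The integrated least-squares loss is continuous in the parameter. -/
theorem continuous_integral_leastSquares {m n : ℕ} {Φ : ℝ → Matrix (Fin m) (Fin n) ℝ}
    {y : ℝ → Fin m → ℝ} (hΦ : ContinuousOn Φ (Set.Ici 0)) (hy : ContinuousOn y (Set.Ici 0))
    {t : ℝ} (ht : 0 ≤ t) :
    Continuous fun θ : Fin n → ℝ =>
      ∫ s in (0:ℝ)..t, (1/2) * ∑ j, ((Φ s).mulVec θ j - y s j) ^ 2 := by
  have hmax : Continuous fun s : ℝ => max s 0 := by fun_prop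
  have hΦ' : Continuous fun s : ℝ => Φ (max s 0) :=
    hΦ.comp_continuous hmax fun s => le_max_right s 0
  have hy' : Continuous fun s : ℝ => y (max s 0) :=
    hy.comp_continuous hmax fun s => le_max_right s 0
  have h : Continuous fun θ : Fin n → ℝ => ∫ s in (0:ℝ)..t,
      (1/2) * ∑ j, ((Φ (max s 0)).mulVec θ j - y (max s 0) j) ^ 2 := by
    apply intervalIntegral.continuous_parametric_intervalIntegral_of_continuous'
    have h₁ : Continuous fun z : (Fin n → ℝ) × ℝ => (Φ (max z.2 0)).mulVec z.1 :=
      (hΦ'.comp continuous_snd).matrix_mulVec continuous_fst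
    have h₂ : Continuous fun z : (Fin n → ℝ) × ℝ => y (max z.2 0) := hy'.comp continuous_snd
    exact continuous_const.mul (continuous_finsetSum _ fun j _ =>
      (((continuous_apply j).comp h₁).sub ((continuous_apply j).comp h₂)).pow 2)
  refine h.congr fun θ => intervalIntegral.integral_congr fun s hs => ?_
  rw [Set.uIcc_of_le ht] at hs
  simp only [max_eq_left hs.1]

/-- Expanding the quadratic form of a symmetric invertible matrix around `M⁻¹ b`. -/
theorem Matrix.IsSymm.sub_inv_mulVec_dotProduct {n : ℕ} {M : Matrix (Fin n) (Fin n) ℝ}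
    (hM : M.IsSymm) (hdet : IsUnit M.det) (b θ : Fin n → ℝ) :
    (θ - M⁻¹.mulVec b) ⬝ᵥ M.mulVec (θ - M⁻¹.mulVec b) =
      θ ⬝ᵥ M.mulVec θ - 2 * (b ⬝ᵥ θ) + b ⬝ᵥ M⁻¹.mulVec b := by
  have hb : M.mulVec (M⁻¹.mulVec b) = b := by
    rw [Matrix.mulVec_mulVec, Matrix.mul_nonsing_inv _ hdet, Matrix.one_mulVec]
  have hcross : M⁻¹.mulVec b ⬝ᵥ M.mulVec θ = b ⬝ᵥ θ := by
    rw [Matrix.dotProduct_mulVec, ← Matrix.mulVec_transpose, hM.eq, hb]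
  rw [Matrix.mulVec_sub, hb, sub_dotProduct, dotProduct_sub, dotProduct_sub, hcross,
    dotProduct_comm θ b, dotProduct_comm (M⁻¹.mulVec b) b]
  ring

/-- A nonnegative continuous function plus a positive definite quadratic attains its minimum. -/
theorem Matrix.PosDef.exists_forall_add_quadratic_le {n : ℕ} {M : Matrix (Fin n) (Fin n) ℝ}
    (hM : M.PosDef) {L : (Fin n → ℝ) → ℝ} (hL : Continuous L) (hL₀ : ∀ θ, 0 ≤ L θ)
    (c : Fin n → ℝ) :
    ∃ θ₀, ∀ θ, L θ₀ + (1/2) * ((θ₀ - c) ⬝ᵥ M.mulVec (θ₀ - c)) ≤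
      L θ + (1/2) * ((θ - c) ⬝ᵥ M.mulVec (θ - c)) := by
  obtain ⟨a, ha, hle⟩ := hM.exists_pos_mul_norm_sq_le
  have hcont : Continuous fun θ => L θ + (1/2) * ((θ - c) ⬝ᵥ M.mulVec (θ - c)) := by fun_prop
  refine hcont.exists_forall_le ?_
  have hnorm : Filter.Tendsto (fun θ : Fin n → ℝ => ‖θ - c‖) (Filter.cocompact _) Filter.atTop :=
    (tendsto_norm_cocompact_atTop (E := Fin n → ℝ)).comp
      (Homeomorph.subRight c).isClosedEmbedding.tendsto_cocompact
  have hsq := ((Filter.tendsto_pow_atTop (two_ne_zero)).comp hnorm).const_mul_atTop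
    (half_pos ha)
  refine Filter.tendsto_atTop_mono (fun θ => ?_) hsq
  have := hle (θ - c)
  have := hL₀ θ
  simp only [Function.comp_apply]
  linarith

/-- The minimal value of the regularized learning problem
`min_θ [ ∫₀ᵗ ½‖Φ(s)θ − y(s)‖² ds + ½(θ − M⁻¹b)ᵀM(θ − M⁻¹b) ]` is attained and equals
`−S(b,t) + ½bᵀM⁻¹b`, where
`S(x,t) = sup_p { ⟨x,p⟩ − ∫₀ᵗ ½‖Φ(s)p − y(s)‖² ds − ½pᵀMp }` is the generalized Hopf
formula. -/
theorem stmt11 {m n : ℕ} (Φ : ℝ → Matrix (Fin m) (Fin n) ℝ) (y : ℝ → Fin m → ℝ)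
    (hΦ : ContinuousOn Φ (Set.Ici 0)) (hy : ContinuousOn y (Set.Ici 0))
    (M : Matrix (Fin n) (Fin n) ℝ) (hMs : M.IsSymm) (hMpd : M.PosDef)
    (b : Fin n → ℝ)
    (S : (Fin n → ℝ) → ℝ → ℝ)
    (hS : ∀ (x : Fin n → ℝ) (t : ℝ),
      S x t = ⨆ p : Fin n → ℝ,
        (x ⬝ᵥ p - (∫ s in (0:ℝ)..t, (1/2) * ∑ j, ((Φ s).mulVec p j - y s j) ^ 2)
          - (1/2) * (p ⬝ᵥ M.mulVec p))) :
    ∀ t : ℝ, 0 ≤ t →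
      IsLeast
        (Set.range fun θ : Fin n → ℝ =>
          (∫ s in (0:ℝ)..t, (1/2) * ∑ j, ((Φ s).mulVec θ j - y s j) ^ 2)
            + (1/2) * ((θ - M⁻¹.mulVec b) ⬝ᵥ M.mulVec (θ - M⁻¹.mulVec b)))
        (-S b t + (1/2) * (b ⬝ᵥ M⁻¹.mulVec b)) := by
  intro t ht
  set L : (Fin n → ℝ) → ℝ := fun θ =>
    ∫ s in (0:ℝ)..t, (1/2) * ∑ j, ((Φ s).mulVec θ j - y s j) ^ 2 with hLdef
  have hL₀ : ∀ θ, 0 ≤ L θ := fun θ =>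
    intervalIntegral.integral_nonneg ht fun s _ => by positivity
  obtain ⟨θ₀, hmin⟩ := hMpd.exists_forall_add_quadratic_le
    (continuous_integral_leastSquares hΦ hy ht) hL₀ (M⁻¹.mulVec b)
  have hexp := hMs.sub_inv_mulVec_dotProduct hMpd.det_pos.ne'.isUnit b
  have hSb : S b t = b ⬝ᵥ θ₀ - L θ₀ - (1/2) * (θ₀ ⬝ᵥ M.mulVec θ₀) := by
    rw [hS]
    refine IsGreatest.csSup_eq ⟨⟨θ₀, rfl⟩, ?_⟩
    rintro _ ⟨p, rfl⟩
    have h := hmin p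
    rw [hexp, hexp] at h
    simp only [hLdef] at h ⊢
    linarith
  have hval : -S b t + (1/2) * (b ⬝ᵥ M⁻¹.mulVec b) =
      L θ₀ + (1/2) * ((θ₀ - M⁻¹.mulVec b) ⬝ᵥ M.mulVec (θ₀ - M⁻¹.mulVec b)) := by
    rw [hSb, hexp]
    ring
  rw [hval]
  refine ⟨⟨θ₀, rfl⟩, ?_⟩
  rintro _ ⟨θ, rfl⟩
  exact hmin θ
end

section
/- Let Φ : [0,∞) → ℝ^{m×n} and y : [0,∞) → ℝ^m be continuous, let Γ ∈ ℝ^{n×n} be a diagonal matrix with positive diagonal entries, and let θ⁰ ∈ ℝ^n. Suppose P : [0,∞) → ℝ^{n×n} and q : [0,∞) → ℝ^n are continuous, differentiable on (0,∞), and satisfy the Riccati ODEs P′(t) = −P(t)ᵀΦ(t)ᵀΦ(t)P(t) and q′(t) = −P(t)ᵀΦ(t)ᵀ(Φ(t)q(t) − y(t)) for t > 0, with initial conditions P(0) = Γ⁻¹ and q(0) = 0. Then for every t ≥ 0, θ*(t) = P(t)Γθ⁰ + q(t) is the unique global minimizer over θ ∈ ℝ^n of the loss L(θ; t) = ∫₀ᵗ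 ½‖Φ(s)θ − y(s)‖₂² ds + ½(θ − θ⁰)ᵀΓ(θ − θ⁰). -/
open Matrix

/-- A function continuous on `[0,∞)` whose derivative vanishes on `(0,∞)` is constant there. -/
lemma eq_initial_of_hasDerivAt_zero {f : ℝ → ℝ} (hf : ContinuousOn f (Set.Ici 0))
    (hf' : ∀ t, 0 < t → HasDerivAt f 0 t) {t : ℝ} (ht : 0 ≤ t) : f t = f 0 := by
  rcases ht.eq_or_lt with rfl | ht
  · rfl
  · obtain ⟨c, -, hc⟩ := exists_hasDerivAt_eq_slope f (fun _ => 0) ht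
      (hf.mono Set.Icc_subset_Ici_self) (fun x hx => hf' x hx.1)
    rw [eq_div_iff (by linarith)] at hc
    linarith

/-- A nonnegative function with `f′ ≤ K f` and `f 0 = 0` vanishes. -/
lemma eq_zero_of_hasDerivAt_le {f f' : ℝ → ℝ} {K t : ℝ} (ht : 0 ≤ t)
    (hf : ContinuousOn f (Set.Icc 0 t)) (hf' : ∀ s ∈ Set.Ioo 0 t, HasDerivAt f (f' s) s)
    (hle : ∀ s ∈ Set.Ioo 0 t, f' s ≤ K * f s) (h0 : f 0 = 0) (hnn : 0 ≤ f t) : f t = 0 := by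
  have hder : ∀ s ∈ Set.Ioo 0 t, HasDerivAt (fun s => Real.exp (-K * s) * f s)
      (Real.exp (-K * s) * (-K * 1) * f s + Real.exp (-K * s) * f' s) s := fun s hs =>
    (((hasDerivAt_id s).const_mul (-K)).exp).mul (hf' s hs)
  have hanti : AntitoneOn (fun s => Real.exp (-K * s) * f s) (Set.Icc 0 t) := by
    apply antitoneOn_of_deriv_nonpos (convex_Icc 0 t)
    · exact (Continuous.continuousOn (by fun_prop)).mul hf
    · rw [interior_Icc]
      exact fun s hs => (hder s hs).differentiableAt.differentiableWithinAt
    · rw [interior_Icc]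
      intro s hs
      rw [(hder s hs).deriv]
      have := mul_le_mul_of_nonneg_left (hle s hs) (Real.exp_pos (-K * s)).le
      linarith
  have h := hanti (Set.left_mem_Icc.2 ht) (Set.right_mem_Icc.2 ht) ht
  simp only [h0, mul_zero] at h
  have := Real.exp_pos (-K * t)
  exact le_antisymm (nonpos_of_mul_nonpos_right h this) hnn

/-- The homogeneous linear equation `d′ = B d` with `d 0 = 0` has only the zero solution. -/
lemma eq_zero_of_linear_ode {ι : Type*} [Fintype ι] {B : ℝ → Matrix ι ι ℝ} {d : ℝ → ι → ℝ}
    (hB : ContinuousOn B (Set.Ici 0)) (hd : ContinuousOn d (Set.Ici 0))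
    (hd' : ∀ t, 0 < t → ∀ i, HasDerivAt (fun τ => d τ i) ((B t *ᵥ d t) i) t)
    (h0 : d 0 = 0) {t : ℝ} (ht : 0 ≤ t) : d t = 0 := by
  have hBij : ∀ i j, ContinuousOn (fun s => B s i j) (Set.Ici 0) := fun i j =>
    ((continuous_apply_apply i j).comp_continuousOn hB :)
  have hdi : ∀ i, ContinuousOn (fun s => d s i) (Set.Ici 0) := fun i =>
    ((continuous_apply i).comp_continuousOn hd :)
  obtain ⟨C, hC⟩ := (isCompact_Icc (a := (0 : ℝ)) (b := t)).exists_bound_of_continuousOn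
    (f := fun s => ∑ i, ∑ j, |B s i j|)
    ((continuousOn_finsetSum _ fun i _ => continuousOn_finsetSum _ fun j _ =>
      (hBij i j).abs).mono Set.Icc_subset_Ici_self)
  have hbound : ∀ s ∈ Set.Icc 0 t, ∀ i j, |B s i j| ≤ C := by
    intro s hs i j
    refine le_trans ?_ ((le_abs_self _).trans (hC s hs))
    exact (Finset.single_le_sum (f := fun j => |B s i j|) (fun _ _ => abs_nonneg _)
      (Finset.mem_univ j)).trans (Finset.single_le_sum (f := fun i => ∑ j, |B s i j|)
        (fun _ _ => Finset.sum_nonneg fun _ _ => abs_nonneg _) (Finset.mem_univ i))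
  have hzero : ∑ i, d t i ^ 2 = 0 := by
    refine eq_zero_of_hasDerivAt_le (f := fun s => ∑ i, d s i ^ 2)
      (f' := fun s => ∑ i, 2 * d s i * (B s *ᵥ d s) i)
      (K := 2 * Fintype.card ι * C) ht ?_ ?_ ?_ ?_ ?_
    · exact (continuousOn_finsetSum _ fun i _ => (hdi i).pow 2).mono Set.Icc_subset_Ici_self
    · intro s hs
      refine HasDerivAt.fun_sum fun i _ => ?_
      exact ((hd' s hs.1 i).pow 2).congr_deriv (by simp)
    · intro s hs
      have key : ∀ i j, 2 * d s i * (B s i j * d s j) ≤ C * (d s i ^ 2 + d s j ^ 2) := by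
        intro i j
        obtain ⟨h1, h2⟩ := abs_le.1 (hbound s (Set.Ioo_subset_Icc_self hs) i j)
        nlinarith [mul_nonneg (sub_nonneg.2 h2) (sq_nonneg (d s i + d s j)),
          mul_nonneg (neg_le_iff_add_nonneg.1 h1) (sq_nonneg (d s i - d s j))]
      calc ∑ i, 2 * d s i * (B s *ᵥ d s) i
          = ∑ i, ∑ j, 2 * d s i * (B s i j * d s j) := by
            simp only [mulVec, dotProduct, Finset.mul_sum]
        _ ≤ ∑ i, ∑ j, C * (d s i ^ 2 + d s j ^ 2) :=
            Finset.sum_le_sum fun i _ => Finset.sum_le_sum fun j _ => key i j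
        _ = 2 * Fintype.card ι * C * ∑ i, d s i ^ 2 := by
            simp only [← Finset.mul_sum, Finset.sum_add_distrib, Finset.sum_const,
              Finset.card_univ, nsmul_eq_mul]
            ring
    · simp [h0]
    · positivity
  ext i
  have := (Finset.sum_eq_zero_iff_of_nonneg fun i _ => sq_nonneg (d t i)).1 hzero i
    (Finset.mem_univ i)
  simpa using this

section Riccati

variable {m n : ℕ} {Φ : ℝ → Matrix (Fin m) (Fin n) ℝ} {y : ℝ → Fin m → ℝ} {γ : Fin n → ℝ}
  {P : ℝ → Matrix (Fin n) (Fin n) ℝ} {q : ℝ → Fin n → ℝ}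

/-- The regularized Gram matrix `Γ + ∫₀ᵗ ΦᵀΦ`, where `Γ` is the diagonal matrix of `γ`. -/
noncomputable def regularizedGram (Φ : ℝ → Matrix (Fin m) (Fin n) ℝ) (γ : Fin n → ℝ) (t : ℝ) :
    Matrix (Fin n) (Fin n) ℝ :=
  .of fun i j => diagonal γ i j + ∫ s in (0:ℝ)..t, ((Φ s)ᵀ * Φ s) i j

/-- The moment vector `∫₀ᵗ Φᵀy`. -/
noncomputable def momentVector (Φ : ℝ → Matrix (Fin m) (Fin n) ℝ) (y : ℝ → Fin m → ℝ) (t : ℝ) :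
    Fin n → ℝ :=
  fun i => ∫ s in (0:ℝ)..t, ((Φ s)ᵀ *ᵥ y s) i

lemma regularizedGram_zero : regularizedGram Φ γ 0 = diagonal γ := by
  ext i j
  simp [regularizedGram]

lemma momentVector_zero : momentVector Φ y 0 = 0 := by
  ext i
  simp [momentVector]

lemma hasDerivAt_regularizedGram (hΦ : Continuous Φ) (t : ℝ) (i j : Fin n) :
    HasDerivAt (fun τ => regularizedGram Φ γ τ i j) (((Φ t)ᵀ * Φ t) i j) t := by
  have hc : Continuous fun s => ((Φ s)ᵀ * Φ s) i j := by fun_prop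
  exact (hc.integral_hasStrictDerivAt 0 t).hasDerivAt.const_add _

lemma hasDerivAt_momentVector (hΦ : Continuous Φ) (hy : Continuous y) (t : ℝ) (i : Fin n) :
    HasDerivAt (fun τ => momentVector Φ y τ i) (((Φ t)ᵀ *ᵥ y t) i) t := by
  have hc : Continuous fun s => ((Φ s)ᵀ *ᵥ y s) i := by fun_prop
  exact (hc.integral_hasStrictDerivAt 0 t).hasDerivAt

lemma continuous_regularizedGram (hΦ : Continuous Φ) : Continuous (regularizedGram Φ γ) :=
  continuous_matrix fun i j => continuous_iff_continuousAt.2 fun t =>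
    (hasDerivAt_regularizedGram hΦ t i j).continuousAt

lemma continuous_momentVector (hΦ : Continuous Φ) (hy : Continuous y) :
    Continuous (momentVector Φ y) :=
  continuous_pi fun i => continuous_iff_continuousAt.2 fun t =>
    (hasDerivAt_momentVector hΦ hy t i).continuousAt

/-- Solutions of the Riccati equation with symmetric initial value stay symmetric. -/
lemma riccati_transpose_eq (hPcont : ContinuousOn P (Set.Ici 0))
    (hPode : ∀ t : ℝ, 0 < t → ∀ i j : Fin n,
      HasDerivAt (fun τ => P τ i j) ((-((P t)ᵀ * ((Φ t)ᵀ * Φ t) * P t)) i j) t)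
    (hP0 : (P 0)ᵀ = P 0) {t : ℝ} (ht : 0 ≤ t) : (P t)ᵀ = P t := by
  ext i j
  have hPij : ∀ i j, ContinuousOn (fun s => P s i j) (Set.Ici 0) := fun i j =>
    ((continuous_apply_apply i j).comp_continuousOn hPcont :)
  have h := eq_initial_of_hasDerivAt_zero (f := fun s => P s j i - P s i j)
    ((hPij j i).sub (hPij i j)) (fun s hs => by
      refine ((hPode s hs j i).sub (hPode s hs i j)).congr_deriv ?_
      have hsymm : ((P s)ᵀ * ((Φ s)ᵀ * Φ s) * P s)ᵀ = (P s)ᵀ * ((Φ s)ᵀ * Φ s) * P s := by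
        simp [transpose_mul, Matrix.mul_assoc]
      rw [neg_apply, neg_apply, ← congrFun₂ hsymm i j, transpose_apply, sub_self]) ht
  have h0 : P 0 j i = P 0 i j := congrFun₂ hP0 i j
  simp only [h0, sub_self] at h
  exact sub_eq_zero.1 h

/-- The Riccati solution inverts the regularized Gram matrix. -/
lemma regularizedGram_mul_riccati (hΦ : Continuous Φ) (hγ : ∀ i, 0 < γ i)
    (hPcont : ContinuousOn P (Set.Ici 0))
    (hPode : ∀ t : ℝ, 0 < t → ∀ i j : Fin n,
      HasDerivAt (fun τ => P τ i j) ((-((P t)ᵀ * ((Φ t)ᵀ * Φ t) * P t)) i j) t)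
    (hP0 : P 0 = (diagonal γ)⁻¹) {t : ℝ} (ht : 0 ≤ t) :
    regularizedGram Φ γ t * P t = 1 := by
  have hsymm : ∀ s, 0 ≤ s → (P s)ᵀ = P s := fun s hs => by
    refine riccati_transpose_eq hPcont hPode ?_ hs
    rw [hP0, transpose_nonsing_inv, diagonal_transpose]
  have hM := continuous_regularizedGram (γ := γ) hΦ
  have hunit : IsUnit (diagonal γ).det := by
    rw [det_diagonal, isUnit_iff_ne_zero]
    exact Finset.prod_ne_zero_iff.2 fun i _ => (hγ i).ne'
  ext i j
  have h := eq_zero_of_linear_ode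
    (B := fun s => -((Φ s)ᵀ * Φ s * P s)ᵀ)
    (d := fun s => (regularizedGram Φ γ s * P s - 1) i) (by fun_prop) ?_ ?_ ?_ ht
  · exact sub_eq_zero.1 (congrFun h j)
  · have : ContinuousOn (fun s => regularizedGram Φ γ s * P s - 1) (Set.Ici 0) := by fun_prop
    exact ((continuous_apply i).comp_continuousOn this :)
  · intro s hs k
    have hD : HasDerivAt (fun τ => (regularizedGram Φ γ τ * P τ - 1) i k)
        (∑ l, (((Φ s)ᵀ * Φ s) i l * P s l k + regularizedGram Φ γ s i l *
          (-((P s)ᵀ * ((Φ s)ᵀ * Φ s) * P s)) l k)) s := by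
      simp only [Matrix.sub_apply, Matrix.mul_apply (M := regularizedGram Φ γ _)]
      exact (HasDerivAt.fun_sum fun l _ =>
        (hasDerivAt_regularizedGram hΦ s i l).mul (hPode s hs l k)).sub_const _
    convert hD using 1
    rw [hsymm s hs.le, Finset.sum_add_distrib, ← Matrix.mul_apply, ← Matrix.mul_apply,
      ← Matrix.add_apply, neg_mulVec, mulVec_transpose]
    have hrow : ∀ (X : Matrix (Fin n) (Fin n) ℝ) (Y : Matrix (Fin n) (Fin n) ℝ),
        (X i ᵥ* Y) k = (X * Y) i k := fun X Y => rfl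
    rw [Pi.neg_apply, hrow, ← Matrix.neg_apply]
    refine congrFun₂ (?_ : (_ : Matrix (Fin n) (Fin n) ℝ) = _) i k
    simp only [Matrix.sub_mul, Matrix.mul_neg, Matrix.one_mul, Matrix.mul_assoc]
    abel
  · simp [regularizedGram_zero, hP0, mul_nonsing_inv _ hunit]
    rfl

/-- The affine part `q` solves the normal equations without prior mean. -/
lemma regularizedGram_mulVec_riccati (hΦ : Continuous Φ) (hy : Continuous y)
    (hsymm : ∀ t, 0 ≤ t → (P t)ᵀ = P t)
    (hinv : ∀ t, 0 ≤ t → regularizedGram Φ γ t * P t = 1)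
    (hqcont : ContinuousOn q (Set.Ici 0))
    (hqode : ∀ t : ℝ, 0 < t → ∀ i : Fin n,
      HasDerivAt (fun τ => q τ i)
        ((-(P t)ᵀ.mulVec ((Φ t)ᵀ.mulVec ((Φ t).mulVec (q t) - y t))) i) t)
    (hq0 : q 0 = 0) {t : ℝ} (ht : 0 ≤ t) :
    regularizedGram Φ γ t *ᵥ q t = momentVector Φ y t := by
  have hM := continuous_regularizedGram (γ := γ) hΦ
  have hb := continuous_momentVector hΦ hy
  ext i
  have hcont : ContinuousOn (fun s => regularizedGram Φ γ s *ᵥ q s - momentVector Φ y s)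
      (Set.Ici 0) := by fun_prop
  have h := eq_initial_of_hasDerivAt_zero
    (f := fun s => (regularizedGram Φ γ s *ᵥ q s - momentVector Φ y s) i)
    ((continuous_apply i).comp_continuousOn hcont :) (fun s hs => ?_) ht
  · simpa [hq0, momentVector_zero, sub_eq_zero] using h
  · have hD : HasDerivAt (fun τ => (regularizedGram Φ γ τ *ᵥ q τ - momentVector Φ y τ) i)
        ((∑ l, (((Φ s)ᵀ * Φ s) i l * q s l + regularizedGram Φ γ s i l *
          (-(P s)ᵀ.mulVec ((Φ s)ᵀ.mulVec ((Φ s).mulVec (q s) - y s))) l))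
          - ((Φ s)ᵀ *ᵥ y s) i) s := by
      simp only [Pi.sub_apply, mulVec.eq_1 (regularizedGram Φ γ _), dotProduct]
      exact (HasDerivAt.fun_sum fun l _ =>
        (hasDerivAt_regularizedGram hΦ s i l).mul (hqode s hs l)).sub
          (hasDerivAt_momentVector hΦ hy s i)
    convert hD using 1
    have hvec : ((Φ s)ᵀ * Φ s) *ᵥ q s + regularizedGram Φ γ s *ᵥ
        (-(P s)ᵀ.mulVec ((Φ s)ᵀ.mulVec ((Φ s).mulVec (q s) - y s))) - (Φ s)ᵀ *ᵥ y s = 0 := by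
      rw [hsymm s hs.le, mulVec_neg, mulVec_mulVec _ (regularizedGram Φ γ s), hinv s hs.le,
        one_mulVec, mulVec_sub, mulVec_mulVec]
      abel
    rw [Finset.sum_add_distrib]
    exact (congrFun hvec i).symm

/-- Completing the square for the regularized least-squares loss at a solution `x` of the
normal equations. -/
lemma leastSquares_eq_add (hΦ : Continuous Φ) (hy : Continuous y) (θ0 x θ : Fin n → ℝ) (t : ℝ)
    (hx : regularizedGram Φ γ t *ᵥ x = diagonal γ *ᵥ θ0 + momentVector Φ y t) :
    (∫ s in (0:ℝ)..t, (1/2) * ∑ j, ((Φ s *ᵥ θ) j - y s j) ^ 2)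
        + (1/2) * ((θ - θ0) ⬝ᵥ diagonal γ *ᵥ (θ - θ0)) =
      ((∫ s in (0:ℝ)..t, (1/2) * ∑ j, ((Φ s *ᵥ x) j - y s j) ^ 2)
        + (1/2) * ((x - θ0) ⬝ᵥ diagonal γ *ᵥ (x - θ0)))
      + ((∫ s in (0:ℝ)..t, (1/2) * ∑ j, ((Φ s *ᵥ (θ - x)) j) ^ 2)
        + (1/2) * ((θ - x) ⬝ᵥ diagonal γ *ᵥ (θ - x))) := by
  obtain ⟨δ, rfl⟩ : ∃ δ, θ = x + δ := ⟨θ - x, by abel⟩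
  rw [add_sub_cancel_left]
  have hpt : ∀ s, (1/2) * ∑ j, ((Φ s *ᵥ (x + δ)) j - y s j) ^ 2 =
      (1/2) * ∑ j, ((Φ s *ᵥ x) j - y s j) ^ 2 + (1/2) * ∑ j, ((Φ s *ᵥ δ) j) ^ 2
      + ∑ i, δ i * (∑ k, ((Φ s)ᵀ * Φ s) i k * x k - ((Φ s)ᵀ *ᵥ y s) i) := by
    intro s
    have hcross : ∑ i, δ i * (∑ k, ((Φ s)ᵀ * Φ s) i k * x k - ((Φ s)ᵀ *ᵥ y s) i)
        = ∑ j, (Φ s *ᵥ δ) j * ((Φ s *ᵥ x) j - y s j) := by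
      change δ ⬝ᵥ (((Φ s)ᵀ * Φ s) *ᵥ x - (Φ s)ᵀ *ᵥ y s) = (Φ s *ᵥ δ) ⬝ᵥ (Φ s *ᵥ x - y s)
      rw [← mulVec_mulVec, ← mulVec_sub, dotProduct_mulVec, vecMul_transpose]
    rw [hcross, Finset.mul_sum, Finset.mul_sum, Finset.mul_sum, ← Finset.sum_add_distrib,
      ← Finset.sum_add_distrib]
    refine Finset.sum_congr rfl fun j _ => ?_
    rw [mulVec_add, Pi.add_apply]
    ring
  have hcA : ∀ i k, Continuous fun s => ((Φ s)ᵀ * Φ s) i k := fun i k => by fun_prop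
  have hcb : ∀ i, Continuous fun s => ((Φ s)ᵀ *ᵥ y s) i := fun i => by fun_prop
  have hint : (∫ s in (0:ℝ)..t,
      ∑ i, δ i * (∑ k, ((Φ s)ᵀ * Φ s) i k * x k - ((Φ s)ᵀ *ᵥ y s) i))
      = δ ⬝ᵥ (diagonal γ *ᵥ θ0 - diagonal γ *ᵥ x) := by
    have hcs : ∀ i, Continuous fun s => ∑ k, ((Φ s)ᵀ * Φ s) i k * x k := fun i =>
      continuous_finsetSum _ fun k _ => (hcA i k).mul continuous_const
    have hcd : ∀ i, Continuous fun s =>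
        δ i * (∑ k, ((Φ s)ᵀ * Φ s) i k * x k - ((Φ s)ᵀ *ᵥ y s) i) := fun i =>
      continuous_const.mul ((hcs i).sub (hcb i))
    have hce : ∀ i k, Continuous fun s => ((Φ s)ᵀ * Φ s) i k * x k := fun i k =>
      (hcA i k).mul continuous_const
    rw [intervalIntegral.integral_finsetSum fun i _ => (hcd i).intervalIntegrable _ _]
    refine Finset.sum_congr rfl fun i _ => ?_
    rw [intervalIntegral.integral_const_mul, intervalIntegral.integral_sub
      ((hcs i).intervalIntegrable _ _) ((hcb i).intervalIntegrable _ _),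
      intervalIntegral.integral_finsetSum fun k _ =>
        (hce i k).intervalIntegrable _ _]
    simp only [intervalIntegral.integral_mul_const]
    have h := congrFun hx i
    simp only [mulVec, dotProduct, regularizedGram, of_apply, add_mul, Finset.sum_add_distrib,
      Pi.add_apply, momentVector] at h
    simp only [mulVec, dotProduct, Pi.sub_apply]
    congr 1
    linarith
  have hquad : (x + δ - θ0) ⬝ᵥ diagonal γ *ᵥ (x + δ - θ0) = (x - θ0) ⬝ᵥ diagonal γ *ᵥ (x - θ0)
      + δ ⬝ᵥ diagonal γ *ᵥ δ - 2 * (δ ⬝ᵥ (diagonal γ *ᵥ θ0 - diagonal γ *ᵥ x)) := by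
    simp only [dotProduct, mulVec_diagonal, Pi.add_apply, Pi.sub_apply, Finset.mul_sum,
      ← Finset.sum_add_distrib, ← Finset.sum_sub_distrib]
    exact Finset.sum_congr rfl fun i _ => by ring
  have hc1 : Continuous fun s => (1/2) * ∑ j, ((Φ s *ᵥ x) j - y s j) ^ 2 := by fun_prop
  have hc2 : Continuous fun s => (1/2) * ∑ j, ((Φ s *ᵥ δ) j) ^ 2 := by fun_prop
  have hc12 : Continuous fun s => (1/2) * ∑ j, ((Φ s *ᵥ x) j - y s j) ^ 2
      + (1/2) * ∑ j, ((Φ s *ᵥ δ) j) ^ 2 := hc1.add hc2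
  have hc3 : Continuous fun s =>
      ∑ i, δ i * (∑ k, ((Φ s)ᵀ * Φ s) i k * x k - ((Φ s)ᵀ *ᵥ y s) i) := by fun_prop
  simp only [hpt]
  rw [intervalIntegral.integral_add (hc12.intervalIntegrable _ _)
    (hc3.intervalIntegrable _ _), intervalIntegral.integral_add (hc1.intervalIntegrable _ _)
    (hc2.intervalIntegrable _ _), hint, hquad]
  ring

/-- A solution of the normal equations is the unique minimizer of the regularized least-squares
loss. -/
lemma leastSquares_unique_minimizer (hΦ : Continuous Φ) (hy : Continuous y) (hγ : ∀ i, 0 < γ i)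
    (θ0 x : Fin n → ℝ) {t : ℝ} (ht : 0 ≤ t)
    (hx : regularizedGram Φ γ t *ᵥ x = diagonal γ *ᵥ θ0 + momentVector Φ y t)
    {L : (Fin n → ℝ) → ℝ}
    (hL : ∀ θ, L θ = (∫ s in (0:ℝ)..t, (1/2) * ∑ j, ((Φ s *ᵥ θ) j - y s j) ^ 2)
        + (1/2) * ((θ - θ0) ⬝ᵥ diagonal γ *ᵥ (θ - θ0))) :
    (∀ θ, L x ≤ L θ) ∧ (∀ θ, (∀ θ', L θ ≤ L θ') → θ = x) := by
  have hlow : ∀ θ, L x + (1/2) * ∑ i, γ i * (θ i - x i) ^ 2 ≤ L θ := by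
    intro θ
    rw [hL θ, leastSquares_eq_add hΦ hy θ0 x θ t hx, ← hL x]
    have h1 : 0 ≤ ∫ s in (0:ℝ)..t, (1/2) * ∑ j, ((Φ s *ᵥ (θ - x)) j) ^ 2 :=
      intervalIntegral.integral_nonneg ht fun s _ => by positivity
    have h2 : (θ - x) ⬝ᵥ diagonal γ *ᵥ (θ - x) = ∑ i, γ i * (θ i - x i) ^ 2 := by
      simp only [dotProduct, mulVec_diagonal, Pi.sub_apply]
      exact Finset.sum_congr rfl fun i _ => by ring
    rw [h2]
    linarith
  have hterm : ∀ (θ : Fin n → ℝ) i, 0 ≤ γ i * (θ i - x i) ^ 2 := fun θ i =>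
    mul_nonneg (hγ i).le (sq_nonneg _)
  have hnn : ∀ θ : Fin n → ℝ, 0 ≤ ∑ i, γ i * (θ i - x i) ^ 2 := fun θ =>
    Finset.sum_nonneg fun i _ => hterm θ i
  refine ⟨fun θ => by linarith [hlow θ, hnn θ], fun θ hθ => ?_⟩
  have hzero : ∑ i, γ i * (θ i - x i) ^ 2 = 0 := by linarith [hlow θ, hnn θ, hθ x]
  ext i
  have hi := (Finset.sum_eq_zero_iff_of_nonneg fun i _ => hterm θ i).1 hzero i (Finset.mem_univ i)
  have := (mul_eq_zero.1 hi).resolve_left (hγ i).ne'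
  exact sub_eq_zero.1 (pow_eq_zero_iff two_ne_zero |>.1 this)

end Riccati

/-- If `P`, `q` are continuous on `[0,∞)`, differentiable on `(0,∞)`, and solve the
Riccati ODEs `P′ = −PᵀΦᵀΦP`, `q′ = −PᵀΦᵀ(Φq − y)` with `P(0) = Γ⁻¹`, `q(0) = 0`
(`Γ` diagonal with positive diagonal), then for every `t ≥ 0`,
`θ*(t) = P(t)Γθ⁰ + q(t)` is the unique global minimizer of the loss
`L(θ;t) = ∫₀ᵗ ½‖Φ(s)θ − y(s)‖² ds + ½(θ − θ⁰)ᵀΓ(θ − θ⁰)`. -/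
theorem stmt16 {m n : ℕ} (Φ : ℝ → Matrix (Fin m) (Fin n) ℝ) (y : ℝ → Fin m → ℝ)
    (hΦ : ContinuousOn Φ (Set.Ici 0)) (hy : ContinuousOn y (Set.Ici 0))
    (γ : Fin n → ℝ) (hγ : ∀ i, 0 < γ i) (θ0 : Fin n → ℝ)
    (P : ℝ → Matrix (Fin n) (Fin n) ℝ) (q : ℝ → Fin n → ℝ)
    (hPcont : ContinuousOn P (Set.Ici 0)) (hqcont : ContinuousOn q (Set.Ici 0))
    (hPode : ∀ t : ℝ, 0 < t → ∀ i j : Fin n,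
      HasDerivAt (fun τ => P τ i j) ((-((P t)ᵀ * ((Φ t)ᵀ * Φ t) * P t)) i j) t)
    (hqode : ∀ t : ℝ, 0 < t → ∀ i : Fin n,
      HasDerivAt (fun τ => q τ i)
        ((-(P t)ᵀ.mulVec ((Φ t)ᵀ.mulVec ((Φ t).mulVec (q t) - y t))) i) t)
    (hP0 : P 0 = (Matrix.diagonal γ)⁻¹) (hq0 : q 0 = 0) :
    ∀ t : ℝ, 0 ≤ t →
      (let L : (Fin n → ℝ) → ℝ := fun θ =>
        (∫ s in (0:ℝ)..t, (1/2) * ∑ j, ((Φ s).mulVec θ j - y s j) ^ 2)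
          + (1/2) * ((θ - θ0) ⬝ᵥ (Matrix.diagonal γ).mulVec (θ - θ0))
      let θstar : Fin n → ℝ := (P t).mulVec ((Matrix.diagonal γ).mulVec θ0) + q t
      (∀ θ, L θstar ≤ L θ) ∧ (∀ θ, (∀ θ', L θ ≤ L θ') → θ = θstar)) := by
  intro t ht L θstar
  have hmax : Continuous fun s : ℝ => max 0 s := by fun_prop
  have hΦc : Continuous fun s => Φ (max 0 s) :=
    hΦ.comp_continuous hmax fun s => le_max_left 0 s
  have hyc : Continuous fun s => y (max 0 s) :=
    hy.comp_continuous hmax fun s => le_max_left 0 s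
  have hPode' : ∀ s : ℝ, 0 < s → ∀ i j : Fin n, HasDerivAt (fun τ => P τ i j)
      ((-((P s)ᵀ * ((Φ (max 0 s))ᵀ * Φ (max 0 s)) * P s)) i j) s := fun s hs => by
    rw [max_eq_right hs.le]
    exact hPode s hs
  have hqode' : ∀ s : ℝ, 0 < s → ∀ i : Fin n, HasDerivAt (fun τ => q τ i)
      ((-(P s)ᵀ.mulVec ((Φ (max 0 s))ᵀ.mulVec ((Φ (max 0 s)).mulVec (q s) - y (max 0 s)))) i)
      s := fun s hs => by
    rw [max_eq_right hs.le]
    exact hqode s hs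
  have hsymm : ∀ s, 0 ≤ s → (P s)ᵀ = P s := fun s hs =>
    riccati_transpose_eq hPcont hPode
      (by rw [hP0, transpose_nonsing_inv, diagonal_transpose]) hs
  have hinv := fun s (hs : 0 ≤ s) => regularizedGram_mul_riccati hΦc hγ hPcont hPode' hP0 hs
  have hq := regularizedGram_mulVec_riccati hΦc hyc hsymm hinv hqcont hqode' hq0 ht
  refine leastSquares_unique_minimizer hΦc hyc hγ θ0 θstar ht ?_ fun θ => ?_
  · rw [mulVec_add, mulVec_mulVec, hinv t ht, one_mulVec, hq]
  · refine congrArg (· + _) (intervalIntegral.integral_congr fun s hs => ?_)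
    rw [Set.uIcc_of_le ht] at hs
    simp only [max_eq_right hs.1]
end

section
/- Let t > 0, let Φ : [0,t] → ℝ^{m×n} and y : [0,t] → ℝ^m be continuous, let M ∈ ℝ^{n×n} be symmetric positive definite, and let x₀ ∈ ℝ^n. For a continuous control u : [0,t] → ℝ^m, define the trajectory x_u(s) = x₀ + ∫₀ˢ Φ(λ)ᵀ u(λ) dλ and the cost C(u) = ∫₀ᵗ ( ½‖u(s)‖₂² − ⟨y(s), u(s)⟩ ) ds + ½ x_u(t)ᵀ M⁻¹ x_u(t). Then the infimum of C(u) over all continuous controls u is attained and equals S(x₀, t) = sup_{p ∈ ℝ^n} { ⟨x₀,p⟩ − ∫₀ᵗ ½‖Φ(s)p − y(s)‖₂² ds − ½pᵀMp }; moreover, an optimal control is given by u*(s) = y(s) − Φ(s)p*, where p* = ( M + ∫₀ᵗ Φ(s)ᵀΦ(s) ds )⁻¹ ( x₀ + ∫₀ᵗ Φ(s)ᵀ y(s) ds ). -/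
open Matrix

section Continuity

variable {m n k : ℕ} {S : Set ℝ}

lemma continuousOn_mulVec {A : ℝ → Matrix (Fin m) (Fin n) ℝ} {v : ℝ → Fin n → ℝ}
    (hA : ContinuousOn A S) (hv : ContinuousOn v S) :
    ContinuousOn (fun s => (A s).mulVec (v s)) S := by
  rw [continuousOn_iff_continuous_domRestrict] at *
  exact hA.matrix_mulVec hv

lemma continuousOn_dotProduct {v w : ℝ → Fin n → ℝ}
    (hv : ContinuousOn v S) (hw : ContinuousOn w S) :
    ContinuousOn (fun s => v s ⬝ᵥ w s) S := by
  rw [continuousOn_iff_continuous_domRestrict] at *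
  exact hv.dotProduct hw

lemma continuousOn_transpose {A : ℝ → Matrix (Fin m) (Fin n) ℝ}
    (hA : ContinuousOn A S) : ContinuousOn (fun s => (A s)ᵀ) S := by
  rw [continuousOn_iff_continuous_domRestrict] at *
  exact hA.matrix_transpose

lemma continuousOn_matrix_mul {A : ℝ → Matrix (Fin m) (Fin n) ℝ}
    {B : ℝ → Matrix (Fin n) (Fin k) ℝ}
    (hA : ContinuousOn A S) (hB : ContinuousOn B S) :
    ContinuousOn (fun s => A s * B s) S := by
  rw [continuousOn_iff_continuous_domRestrict] at *
  exact hA.matrix_mul hB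

end Continuity

/-- The dot product with a fixed vector commutes with coordinatewise integration. -/
lemma integral_dotProduct {n : ℕ} {t : ℝ} (ht : 0 ≤ t) {f : ℝ → Fin n → ℝ}
    (hf : ContinuousOn f (Set.Icc 0 t)) (p : Fin n → ℝ) :
    (fun i => ∫ s in (0:ℝ)..t, f s i) ⬝ᵥ p = ∫ s in (0:ℝ)..t, f s ⬝ᵥ p := by
  simp only [dotProduct]
  rw [intervalIntegral.integral_finsetSum]
  · simp only [intervalIntegral.integral_mul_const]
  · intro i _
    exact ((continuousOn_pi.1 hf i).mul continuousOn_const).intervalIntegrable_of_Icc ht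

lemma integral_mulVec {m n : ℕ} {t : ℝ} (ht : 0 ≤ t) {A : ℝ → Matrix (Fin m) (Fin n) ℝ}
    (hA : ContinuousOn A (Set.Icc 0 t)) (p : Fin n → ℝ) :
    (Matrix.of fun i j => ∫ s in (0:ℝ)..t, A s i j).mulVec p
      = fun i => ∫ s in (0:ℝ)..t, (A s).mulVec p i := by
  funext i
  exact integral_dotProduct ht (continuousOn_pi.1 hA i) p

/-- The Gram matrix `∫ ΦᵀΦ` is positive semidefinite. -/
lemma posSemidef_integral_transpose_mul {m n : ℕ} {t : ℝ} (ht : 0 ≤ t)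
    {Φ : ℝ → Matrix (Fin m) (Fin n) ℝ} (hΦ : ContinuousOn Φ (Set.Icc 0 t)) :
    (Matrix.of fun i j => ∫ s in (0:ℝ)..t, ((Φ s)ᵀ * Φ s) i j).PosSemidef := by
  have hG := continuousOn_matrix_mul (continuousOn_transpose hΦ) hΦ
  refine Matrix.PosSemidef.of_dotProduct_mulVec_nonneg ?_ fun x => ?_
  · ext i j
    simp [Matrix.conjTranspose, Matrix.mul_apply, mul_comm]
  · rw [integral_mulVec ht hG, star_trivial, dotProduct_comm,
      integral_dotProduct ht (continuousOn_mulVec hG continuousOn_const)]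
    refine intervalIntegral.integral_nonneg ht fun s _ => ?_
    rw [dotProduct_comm, ← Matrix.mulVec_mulVec, Matrix.dotProduct_mulVec,
      Matrix.vecMul_transpose]
    exact dotProduct_self_star_nonneg _

/-- Completing the square in the terminal cost. -/
lemma half_dotProduct_inv_mulVec_sub {n : ℕ} {M : Matrix (Fin n) (Fin n) ℝ} (hMs : M.IsSymm)
    (hM : IsUnit M.det) (x p : Fin n → ℝ) :
    (1/2) * ((x - M.mulVec p) ⬝ᵥ M⁻¹.mulVec (x - M.mulVec p))
      = (1/2) * (x ⬝ᵥ M⁻¹.mulVec x) - x ⬝ᵥ p + (1/2) * (p ⬝ᵥ M.mulVec p) := by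
  have h1 : M⁻¹.mulVec (M.mulVec p) = p := by
    rw [Matrix.mulVec_mulVec, Matrix.nonsing_inv_mul _ hM, Matrix.one_mulVec]
  have h2 : M.mulVec p ⬝ᵥ M⁻¹.mulVec x = x ⬝ᵥ p := by
    rw [dotProduct_comm, Matrix.dotProduct_mulVec, ← Matrix.mulVec_transpose, hMs.eq,
      Matrix.mulVec_mulVec, Matrix.mul_nonsing_inv _ hM, Matrix.one_mulVec]
  rw [Matrix.mulVec_sub, h1, sub_dotProduct, dotProduct_sub, dotProduct_sub, h2,
    dotProduct_comm (M.mulVec p) p]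
  ring

/-- The duality gap between a control `u` and a dual variable `p` as a sum of two squares. -/
lemma cost_sub_dual_eq {m n : ℕ} {t : ℝ} (ht : 0 ≤ t)
    {Φ : ℝ → Matrix (Fin m) (Fin n) ℝ} {y : ℝ → Fin m → ℝ}
    (hΦ : ContinuousOn Φ (Set.Icc 0 t)) (hy : ContinuousOn y (Set.Icc 0 t))
    {M : Matrix (Fin n) (Fin n) ℝ} (hMs : M.IsSymm) (hM : IsUnit M.det)
    (x₀ x p : Fin n → ℝ) {u : ℝ → Fin m → ℝ} (hu : ContinuousOn u (Set.Icc 0 t))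
    (hx : x = x₀ + fun i => ∫ l in (0:ℝ)..t, (Φ l)ᵀ.mulVec (u l) i) :
    ((∫ s in (0:ℝ)..t, ((1/2) * ∑ j, (u s j) ^ 2 - y s ⬝ᵥ u s)) + (1/2) * (x ⬝ᵥ M⁻¹.mulVec x))
      - (x₀ ⬝ᵥ p - (∫ s in (0:ℝ)..t, (1/2) * ∑ j, ((Φ s).mulVec p j - y s j) ^ 2)
          - (1/2) * (p ⬝ᵥ M.mulVec p))
      = (∫ s in (0:ℝ)..t, (1/2) * ∑ j, (u s j - (y s - (Φ s).mulVec p) j) ^ 2)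
        + (1/2) * ((x - M.mulVec p) ⬝ᵥ M⁻¹.mulVec (x - M.mulVec p)) := by
  have hΦp := continuousOn_mulVec hΦ (continuousOn_const (c := p))
  have hΦu := continuousOn_mulVec (continuousOn_transpose hΦ) hu
  have hsq : ∀ {v : ℝ → Fin m → ℝ}, ContinuousOn v (Set.Icc 0 t) →
      ContinuousOn (fun s => (1/2) * ∑ j, (v s j) ^ 2) (Set.Icc 0 t) := fun hv =>
    continuousOn_const.mul (continuousOn_finsetSum _ fun j _ => (continuousOn_pi.1 hv j).pow 2)
  have i1 : IntervalIntegrable (fun s => (1/2) * ∑ j, (u s j) ^ 2 - y s ⬝ᵥ u s)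
      MeasureTheory.volume 0 t :=
    ((hsq hu).sub (continuousOn_dotProduct hy hu)).intervalIntegrable_of_Icc ht
  have i2 : IntervalIntegrable (fun s => (1/2) * ∑ j, ((Φ s).mulVec p j - y s j) ^ 2)
      MeasureTheory.volume 0 t :=
    (hsq (hΦp.sub hy)).intervalIntegrable_of_Icc ht
  have i3 : IntervalIntegrable (fun s => (Φ s)ᵀ.mulVec (u s) ⬝ᵥ p) MeasureTheory.volume 0 t :=
    (continuousOn_dotProduct hΦu continuousOn_const).intervalIntegrable_of_Icc ht
  have hxp : x ⬝ᵥ p = x₀ ⬝ᵥ p + ∫ s in (0:ℝ)..t, (Φ s)ᵀ.mulVec (u s) ⬝ᵥ p := by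
    rw [hx, add_dotProduct, integral_dotProduct ht hΦu]
  have hint : (∫ s in (0:ℝ)..t, (1/2) * ∑ j, (u s j - (y s - (Φ s).mulVec p) j) ^ 2)
      = (∫ s in (0:ℝ)..t, ((1/2) * ∑ j, (u s j) ^ 2 - y s ⬝ᵥ u s))
        + (∫ s in (0:ℝ)..t, (1/2) * ∑ j, ((Φ s).mulVec p j - y s j) ^ 2)
        + ∫ s in (0:ℝ)..t, (Φ s)ᵀ.mulVec (u s) ⬝ᵥ p := by
    rw [← intervalIntegral.integral_add i1 i2, ← intervalIntegral.integral_add (i1.add i2) i3]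
    refine intervalIntegral.integral_congr fun s _ => ?_
    have h : (Φ s)ᵀ.mulVec (u s) ⬝ᵥ p = u s ⬝ᵥ (Φ s).mulVec p := by
      rw [Matrix.mulVec_transpose, Matrix.dotProduct_mulVec]
    simp only [h]
    simp only [dotProduct, Finset.mul_sum, Pi.sub_apply]
    rw [← Finset.sum_sub_distrib, ← Finset.sum_add_distrib, ← Finset.sum_add_distrib]
    exact Finset.sum_congr rfl fun j _ => by ring
  rw [half_dotProduct_inv_mulVec_sub hMs hM, hint, hxp]
  ring

/-- Linear-quadratic optimal control ↔ generalized Hopf formula: for the control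
problem with trajectory `x_u(s) = x₀ + ∫₀ˢ Φ(λ)ᵀu(λ) dλ` and cost
`C(u) = ∫₀ᵗ (½‖u(s)‖² − ⟨y(s),u(s)⟩) ds + ½x_u(t)ᵀM⁻¹x_u(t)`, the infimum of `C`
over continuous controls is attained at `u*(s) = y(s) − Φ(s)p*` with
`p* = (M + ∫₀ᵗΦᵀΦ)⁻¹(x₀ + ∫₀ᵗΦᵀy)`, and its value equals
`S(x₀,t) = sup_p { ⟨x₀,p⟩ − ∫₀ᵗ ½‖Φ(s)p − y(s)‖² ds − ½pᵀMp }`. -/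
theorem stmt17 {m n : ℕ} (t : ℝ) (ht : 0 < t)
    (Φ : ℝ → Matrix (Fin m) (Fin n) ℝ) (y : ℝ → Fin m → ℝ)
    (hΦ : ContinuousOn Φ (Set.Icc 0 t)) (hy : ContinuousOn y (Set.Icc 0 t))
    (M : Matrix (Fin n) (Fin n) ℝ) (hMs : M.IsSymm) (hMpd : M.PosDef)
    (x₀ : Fin n → ℝ)
    (traj : (ℝ → Fin m → ℝ) → ℝ → Fin n → ℝ)
    (htraj : ∀ u s, traj u s = x₀ + fun i => ∫ l in (0:ℝ)..s, (Φ l)ᵀ.mulVec (u l) i)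
    (C : (ℝ → Fin m → ℝ) → ℝ)
    (hC : ∀ u, C u = (∫ s in (0:ℝ)..t, ((1/2) * ∑ j, (u s j) ^ 2 - y s ⬝ᵥ u s))
      + (1/2) * (traj u t ⬝ᵥ M⁻¹.mulVec (traj u t)))
    (pstar : Fin n → ℝ)
    (hp : pstar = (M + Matrix.of fun i j => ∫ s in (0:ℝ)..t, ((Φ s)ᵀ * Φ s) i j)⁻¹.mulVec
      (x₀ + fun i => ∫ s in (0:ℝ)..t, (Φ s)ᵀ.mulVec (y s) i))
    (ustar : ℝ → Fin m → ℝ) (hu : ∀ s, ustar s = y s - (Φ s).mulVec pstar) :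
    ContinuousOn ustar (Set.Icc 0 t)
    ∧ (∀ u : ℝ → Fin m → ℝ, ContinuousOn u (Set.Icc 0 t) → C ustar ≤ C u)
    ∧ C ustar = ⨆ p : Fin n → ℝ,
        (x₀ ⬝ᵥ p - (∫ s in (0:ℝ)..t, (1/2) * ∑ j, ((Φ s).mulVec p j - y s j) ^ 2)
          - (1/2) * (p ⬝ᵥ M.mulVec p)) := by
  have ht0 := ht.le
  have hM : IsUnit M.det := hMpd.det_pos.ne'.isUnit
  have hus : ContinuousOn ustar (Set.Icc 0 t) := by
    rw [funext hu]
    exact hy.sub (continuousOn_mulVec hΦ continuousOn_const)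
  have gap := fun (u : ℝ → Fin m → ℝ) (hc : ContinuousOn u (Set.Icc 0 t)) (p : Fin n → ℝ) =>
    cost_sub_dual_eq ht0 hΦ hy hMs hM x₀ (traj u t) p hc (htraj u t)
  simp only [← hC] at gap
  have weak_duality : ∀ u : ℝ → Fin m → ℝ, ContinuousOn u (Set.Icc 0 t) → ∀ p : Fin n → ℝ,
      x₀ ⬝ᵥ p - (∫ s in (0:ℝ)..t, (1/2) * ∑ j, ((Φ s).mulVec p j - y s j) ^ 2)
        - (1/2) * (p ⬝ᵥ M.mulVec p) ≤ C u := by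
    intro u hc p
    rw [← sub_nonneg, gap u hc p]
    have h1 : 0 ≤ ∫ s in (0:ℝ)..t, (1/2) * ∑ j, (u s j - (y s - (Φ s).mulVec p) j) ^ 2 :=
      intervalIntegral.integral_nonneg ht0 fun s _ => by positivity
    have h2 := hMpd.inv.posSemidef.dotProduct_mulVec_nonneg (traj u t - M.mulVec p)
    rw [star_trivial] at h2
    linarith
  have hterm : traj ustar t = M.mulVec pstar := by
    have hG := continuousOn_matrix_mul (continuousOn_transpose hΦ) hΦ
    have hdet := (hMpd.add_posSemidef (posSemidef_integral_transpose_mul ht0 hΦ)).det_pos.ne'.isUnit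
    have hnormal := congrArg (M + Matrix.of fun i j =>
      ∫ s in (0:ℝ)..t, ((Φ s)ᵀ * Φ s) i j).mulVec hp
    rw [Matrix.mulVec_mulVec, Matrix.mul_nonsing_inv _ hdet, Matrix.one_mulVec,
      Matrix.add_mulVec, integral_mulVec ht0 hG] at hnormal
    rw [htraj, eq_sub_of_add_eq hnormal]
    funext i
    have hsplit : (∫ s in (0:ℝ)..t, (Φ s)ᵀ.mulVec (ustar s) i)
        = (∫ s in (0:ℝ)..t, (Φ s)ᵀ.mulVec (y s) i)
          - ∫ s in (0:ℝ)..t, ((Φ s)ᵀ * Φ s).mulVec pstar i := by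
      rw [← intervalIntegral.integral_sub]
      · simp only [hu, Matrix.mulVec_sub, Matrix.mulVec_mulVec, Pi.sub_apply]
      · exact (continuousOn_pi.1 (continuousOn_mulVec (continuousOn_transpose hΦ) hy)
          i).intervalIntegrable_of_Icc ht0
      · exact (continuousOn_pi.1 (continuousOn_mulVec hG continuousOn_const)
          i).intervalIntegrable_of_Icc ht0
    simp only [Pi.add_apply, Pi.sub_apply, hsplit]
    ring
  have strong_duality := sub_eq_zero.1 <| (gap ustar hus pstar).trans <| by
    simp [hterm, hu]
  refine ⟨hus, fun u hc => strong_duality ▸ weak_duality u hc pstar, le_antisymm ?_ ?_⟩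
  · rw [strong_duality]
    exact le_ciSup (f := fun p : Fin n → ℝ =>
      x₀ ⬝ᵥ p - (∫ s in (0:ℝ)..t, (1/2) * ∑ j, ((Φ s).mulVec p j - y s j) ^ 2)
        - (1/2) * (p ⬝ᵥ M.mulVec p))
      ⟨C ustar, Set.forall_mem_range.2 (weak_duality ustar hus)⟩ pstar
  · exact ciSup_le (weak_duality ustar hus)
end
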